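/- Bounds on eigenvalues of CSSL solutions: let d, N ≥ 1, S₁, …, S_N symmetric positive semidefinite real d×d matrices, t₁, …, t_N > 0 with Σᵢ tᵢ = 1, p ∈ [1, ∞), and suppose 0 < ρ < N^{1/p} γ. If (Θ*, Ω*) maximizes the CSSL objective g over all (Θ, Ω) with Θ + Ωᵢ symmetric positive definite for every i, then for each i the matrix Λᵢ* = Θ* + Ωᵢ* satisfies λᵢ^{min} I_d ⪯ Λᵢ* ⪯ λᵢ^{max} I_d (in the Loewner order), where λᵢ^{min} = tᵢ / (tᵢ ‖Sᵢ‖_S + dγ) and λᵢ^{max} = N^{1/p} d² / ρ, and ‖Sᵢ‖_S denotes the spectral norm (largest singular value) of Sᵢ. -/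

import Mathlib

noncomputable def matL1 {d : ℕ} (A : Matrix (Fin d) (Fin d) ℝ) : ℝ :=
  ∑ j, ∑ j', |A j j'|

noncomputable def matL1p {d N : ℕ} (p : ℝ) (Ω : Fin N → Matrix (Fin d) (Fin d) ℝ) : ℝ :=
  ∑ j : Fin d, ∑ j' : Fin d, (∑ i, |Ω i j j'| ^ p) ^ (1 / p)

/-- The CSSL objective `g(Θ, Ω)`. -/
noncomputable def cssl {d N : ℕ} (S : Fin N → Matrix (Fin d) (Fin d) ℝ) (t : Fin N → ℝ)
    (ρ γ p : ℝ) (Θ : Matrix (Fin d) (Fin d) ℝ) (Ω : Fin N → Matrix (Fin d) (Fin d) ℝ) : ℝ :=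
  ∑ i, t i * (Real.log (Θ + Ω i).det - Matrix.trace (S i * (Θ + Ω i)))
    - ρ * matL1 Θ - γ * matL1p p Ω

/-- The spectral norm (largest singular value) of a real square matrix, realized as the
`ℓ²`-operator norm. -/
noncomputable def specNorm {d : ℕ} (A : Matrix (Fin d) (Fin d) ℝ) : ℝ :=
  ‖Matrix.toEuclideanCLM (𝕜 := ℝ) A‖

open Matrix

section EntrywiseNorms

variable {d N : ℕ}

theorem matL1_nonneg (A : Matrix (Fin d) (Fin d) ℝ) : 0 ≤ matL1 A := by
  unfold matL1; positivity

theorem matL1_add_le (A B : Matrix (Fin d) (Fin d) ℝ) : matL1 (A + B) ≤ matL1 A + matL1 B := by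
  simp only [matL1, ← Finset.sum_add_distrib]
  gcongr with j _ j' _
  exact abs_add_le _ _

theorem matL1_smul {c : ℝ} (hc : 0 ≤ c) (A : Matrix (Fin d) (Fin d) ℝ) :
    matL1 (c • A) = c * matL1 A := by
  simp [matL1, abs_mul, abs_of_nonneg hc, Finset.mul_sum]

theorem matL1p_nonneg (p : ℝ) (Ω : Fin N → Matrix (Fin d) (Fin d) ℝ) : 0 ≤ matL1p p Ω := by
  unfold matL1p; positivity

theorem matL1p_add_le {p : ℝ} (hp : 1 ≤ p) (Ω Ω' : Fin N → Matrix (Fin d) (Fin d) ℝ) :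
    matL1p p (Ω + Ω') ≤ matL1p p Ω + matL1p p Ω' := by
  simp only [matL1p, ← Finset.sum_add_distrib]
  gcongr with j _ j' _
  exact Real.Lp_add_le Finset.univ (fun i => Ω i j j') (fun i => Ω' i j j') hp

theorem matL1p_smul {p : ℝ} (hp : 1 ≤ p) {c : ℝ} (hc : 0 ≤ c)
    (Ω : Fin N → Matrix (Fin d) (Fin d) ℝ) : matL1p p (c • Ω) = c * matL1p p Ω := by
  have hp0 : p ≠ 0 := by positivity
  simp only [matL1p, Finset.mul_sum]
  refine Finset.sum_congr rfl fun j _ => Finset.sum_congr rfl fun j' _ => ?_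
  have h : ∀ i, |(c • Ω) i j j'| ^ p = c ^ p * |Ω i j j'| ^ p := fun i => by
    simp [abs_mul, abs_of_nonneg hc, Real.mul_rpow hc (abs_nonneg _)]
  simp_rw [h, ← Finset.mul_sum]
  rw [Real.mul_rpow (by positivity) (by positivity), one_div, Real.rpow_rpow_inv hc hp0]

theorem matL1p_single {p : ℝ} (hp : 1 ≤ p) (i : Fin N) (B : Matrix (Fin d) (Fin d) ℝ) :
    matL1p p (Pi.single i B) = matL1 B := by
  have hp0 : p ≠ 0 := by positivity
  simp only [matL1p, matL1]
  refine Finset.sum_congr rfl fun j _ => Finset.sum_congr rfl fun j' _ => ?_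
  rw [Finset.sum_eq_single i (fun k _ hk => by simp [hk, hp0]) (by simp), Pi.single_eq_same,
    one_div, Real.rpow_rpow_inv (abs_nonneg _) hp0]

theorem matL1_le_matL1p {p : ℝ} (hp : 1 ≤ p) (i : Fin N)
    (Ω : Fin N → Matrix (Fin d) (Fin d) ℝ) : matL1 (Ω i) ≤ matL1p p Ω := by
  have hp0 : p ≠ 0 := by positivity
  simp only [matL1p, matL1]
  gcongr with j _ j' _
  calc |Ω i j j'| = (|Ω i j j'| ^ p) ^ (1 / p) := by
        rw [one_div, Real.rpow_rpow_inv (abs_nonneg _) hp0]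
    _ ≤ _ := by
        gcongr
        exact Finset.single_le_sum (f := fun k => |Ω k j j'| ^ p)
          (fun k _ => by positivity) (Finset.mem_univ i)

theorem matL1_vecMulVec_self_le (v : Fin d → ℝ) : matL1 (vecMulVec v v) ≤ d * (v ⬝ᵥ v) := by
  have h := sq_sum_le_card_mul_sum_sq (s := Finset.univ) (f := fun j => |v j|)
  simp only [Finset.card_univ, Fintype.card_fin, sq_abs] at h
  simpa [matL1, vecMulVec_apply, abs_mul, ← Finset.sum_mul_sum, dotProduct, sq] using h

theorem dotProduct_mulVec_le_matL1 (A : Matrix (Fin d) (Fin d) ℝ) (x : Fin d → ℝ) :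
    x ⬝ᵥ (A *ᵥ x) ≤ matL1 A * (x ⬝ᵥ x) := by
  have hx : ∀ j, x j ^ 2 ≤ x ⬝ᵥ x := fun j => by
    simpa [dotProduct, sq] using Finset.single_le_sum (f := fun k => x k * x k)
      (fun k _ => mul_self_nonneg _) (Finset.mem_univ j)
  simp only [matL1, Finset.sum_mul]
  rw [dotProduct]
  refine Finset.sum_le_sum fun j _ => ?_
  rw [mulVec, dotProduct, Finset.mul_sum]
  refine Finset.sum_le_sum fun k _ => ?_
  calc x j * (A j k * x k) ≤ |x j * (A j k * x k)| := le_abs_self _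
    _ = |A j k| * (|x j| * |x k|) := by rw [abs_mul, abs_mul]; ring
    _ ≤ |A j k| * (x ⬝ᵥ x) := by
        gcongr
        nlinarith [hx j, hx k, sq_nonneg (|x j| - |x k|), sq_abs (x j), sq_abs (x k)]

theorem posSemidef_smul_one_sub_of_matL1_le {A : Matrix (Fin d) (Fin d) ℝ} (hA : A.IsHermitian)
    {c : ℝ} (h : matL1 A ≤ c) : (c • (1 : Matrix (Fin d) (Fin d) ℝ) - A).PosSemidef := by
  refine .of_dotProduct_mulVec_nonneg ((isHermitian_one.smul (.all c)).sub hA) fun x => ?_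
  have h1 := dotProduct_mulVec_le_matL1 A x
  have h2 : 0 ≤ x ⬝ᵥ x := by simpa using dotProduct_star_self_nonneg x
  simp only [star_trivial, sub_mulVec, smul_mulVec, one_mulVec, dotProduct_sub, dotProduct_smul,
    smul_eq_mul]
  nlinarith

end EntrywiseNorms

section RankOne

variable {d : ℕ}

theorem dotProduct_mulVec_le_specNorm (A : Matrix (Fin d) (Fin d) ℝ) (x : Fin d → ℝ) :
    x ⬝ᵥ (A *ᵥ x) ≤ specNorm A * (x ⬝ᵥ x) := by
  have h := inner_toEuclideanCLM A (WithLp.toLp 2 x) (WithLp.toLp 2 x)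
  have hx : x ⬝ᵥ x = ‖WithLp.toLp 2 x‖ ^ 2 := by
    simp [EuclideanSpace.norm_sq_eq, dotProduct, ← sq]
  simp only at h
  rw [← h, hx, specNorm]
  refine (real_inner_le_norm _ _).trans ?_
  grw [ContinuousLinearMap.le_opNorm]
  exact le_of_eq (by ring)

theorem trace_mul_vecMulVec_self (A : Matrix (Fin d) (Fin d) ℝ) (v : Fin d → ℝ) :
    trace (A * vecMulVec v v) = v ⬝ᵥ (A *ᵥ v) := by
  rw [mul_vecMulVec, trace_vecMulVec, dotProduct_comm]

theorem Matrix.PosSemidef.trace_mul_nonneg {A B : Matrix (Fin d) (Fin d) ℝ} (hA : A.PosSemidef)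
    (hB : B.PosSemidef) : 0 ≤ trace (A * B) := by
  obtain ⟨m, v, rfl⟩ := posSemidef_iff_eq_sum_vecMulVec.mp hB
  simp only [star_trivial, Finset.mul_sum, trace_sum, trace_mul_vecMulVec_self]
  exact Finset.sum_nonneg fun k _ => by simpa using hA.dotProduct_mulVec_nonneg (v k)

theorem det_add_smul_vecMulVec_of_eigenvector {A : Matrix (Fin d) (Fin d) ℝ} {v : Fin d → ℝ}
    {μ : ℝ} (hμ : μ ≠ 0) (hv : A *ᵥ v = μ • v) (ε : ℝ) :
    (A + ε • vecMulVec v v).det = A.det * (1 + ε / μ * (v ⬝ᵥ v)) := by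
  have h : A + ε • vecMulVec v v = A * (1 + vecMulVec ((ε / μ) • v) v) := by
    rw [Matrix.mul_add, Matrix.mul_one, mul_vecMulVec, mulVec_smul, hv, smul_smul,
      div_mul_cancel₀ _ hμ, smul_vecMulVec]
  rw [h, det_mul, vecMulVec_eq Unit, det_one_add_replicateCol_mul_replicateRow, dotProduct_smul,
    smul_eq_mul]

/-- A lower Loewner bound may be checked on unit eigenvectors. -/
theorem posSemidef_sub_smul_one_of_le_eigenvalues {A : Matrix (Fin d) (Fin d) ℝ}
    (hA : A.IsHermitian) {c : ℝ}
    (h : ∀ (μ : ℝ) (v : Fin d → ℝ), v ⬝ᵥ v = 1 → A *ᵥ v = μ • v → c ≤ μ) :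
    (A - c • (1 : Matrix (Fin d) (Fin d) ℝ)).PosSemidef := by
  have hM : (A - c • (1 : Matrix (Fin d) (Fin d) ℝ)).IsHermitian :=
    hA.sub (isHermitian_one.smul (.all c))
  refine hM.posSemidef_iff_eigenvalues_nonneg.mpr fun j => ?_
  have hv := hM.mulVec_eigenvectorBasis j
  have hn : ‖hM.eigenvectorBasis j‖ ^ 2 = 1 := by
    rw [hM.eigenvectorBasis.norm_eq_one j, one_pow]
  have hc := h (hM.eigenvalues j + c) (hM.eigenvectorBasis j)
    (by rw [EuclideanSpace.norm_sq_eq] at hn; simpa [dotProduct, ← sq] using hn)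
    (by rw [add_smul, ← hv, sub_mulVec, smul_mulVec, one_mulVec, sub_add_cancel])
  simpa using hc

end RankOne

section Real

theorem le_of_forall_log_one_add_le {a t K : ℝ} (ha : 0 < a) (ht : 0 ≤ t)
    (h : ∀ ε > 0, t * Real.log (1 + ε * a) ≤ ε * K) : t * a ≤ K := by
  have hb : ∀ ε > 0, t * a ≤ K * (1 + ε * a) := fun ε hε => by
    have h1 : 0 < 1 + ε * a := by positivity
    have h2 := mul_le_mul_of_nonneg_left (Real.one_sub_inv_le_log_of_pos h1) ht
    have h3 : 1 - (1 + ε * a)⁻¹ = ε * a / (1 + ε * a) := by field_simp; ring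
    rw [h3] at h2
    have h4 := h2.trans (h ε hε)
    rw [← mul_div_assoc, div_le_iff₀ h1] at h4
    exact le_of_mul_le_mul_left (by linarith) hε
  have hlim : Filter.Tendsto (fun ε : ℝ => K * (1 + ε * a)) (nhdsWithin 0 (Set.Ioi 0))
      (nhds (K * (1 + 0 * a))) :=
    (Continuous.tendsto (by fun_prop) 0).mono_left nhdsWithin_le_nhds
  simpa using ge_of_tendsto hlim (Filter.eventually_of_mem self_mem_nhdsWithin hb)

theorem le_of_forall_mul_log_le {a K : ℝ} (ha : 0 ≤ a)
    (h : ∀ c, 0 < c → c < 1 → a * Real.log c + (1 - c) * K ≤ 0) : K ≤ a := by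
  have hb : ∀ c, 0 < c → c < 1 → c * K ≤ a := fun c h0 h1 => by
    have h2 := mul_le_mul_of_nonneg_left (Real.one_sub_inv_le_log_of_pos h0) ha
    have h3 := mul_le_mul_of_nonneg_left (h2.trans (by linarith [h c h0 h1] :
      _ ≤ -((1 - c) * K))) h0.le
    have h4 : c * (a * (1 - c⁻¹)) = -((1 - c) * a) := by field_simp; ring
    rw [h4] at h3
    exact le_of_mul_le_mul_left (by linarith) (sub_pos.mpr h1)
  have hlim : Filter.Tendsto (fun c : ℝ => c * K) (nhdsWithin 1 (Set.Iio 1)) (nhds (1 * K)) :=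
    (Continuous.tendsto (by fun_prop) 1).mono_left nhdsWithin_le_nhds
  refine (one_mul K).symm.le.trans (le_of_tendsto hlim ?_)
  filter_upwards [Ioo_mem_nhdsLT (zero_lt_one' ℝ)] with c hc using hb c hc.1 hc.2

end Real

section Objective

variable {d N : ℕ} (S : Fin N → Matrix (Fin d) (Fin d) ℝ) (t : Fin N → ℝ) {p : ℝ} (ρ : ℝ) {γ : ℝ}
  (Θ : Matrix (Fin d) (Fin d) ℝ) (Ω : Fin N → Matrix (Fin d) (Fin d) ℝ)

theorem cssl_add_single_ge (hp : 1 ≤ p) (hγ : 0 ≤ γ) (i : Fin N) (B : Matrix (Fin d) (Fin d) ℝ) :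
    cssl S t ρ γ p Θ Ω + t i * (Real.log (Θ + Ω i + B).det - Real.log (Θ + Ω i).det
      - trace (S i * B)) - γ * matL1 B ≤ cssl S t ρ γ p Θ (Ω + Pi.single i B) := by
  have hsum : ∑ k, t k * (Real.log (Θ + (Ω + Pi.single i B : Fin N → Matrix _ _ ℝ) k).det
        - trace (S k * (Θ + (Ω + Pi.single i B : Fin N → Matrix _ _ ℝ) k)))
      - ∑ k, t k * (Real.log (Θ + Ω k).det - trace (S k * (Θ + Ω k)))
      = t i * (Real.log (Θ + Ω i + B).det - Real.log (Θ + Ω i).det - trace (S i * B)) := by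
    rw [← Finset.sum_sub_distrib,
      Finset.sum_eq_single i (fun k _ hk => by simp [hk]) (by simp)]
    simp only [Pi.add_apply, Pi.single_eq_same, ← add_assoc, Matrix.mul_add, trace_add]
    ring
  have hL := mul_le_mul_of_nonneg_left (matL1p_add_le hp Ω (Pi.single i B)) hγ
  rw [matL1p_single hp] at hL
  unfold cssl
  linarith

theorem cssl_smul (hp : 1 ≤ p) (htsum : ∑ i, t i = 1) (hdet : ∀ i, (Θ + Ω i).det ≠ 0)
    {c : ℝ} (hc : 0 < c) :
    cssl S t ρ γ p (c • Θ) (c • Ω) = cssl S t ρ γ p Θ Ω + d * Real.log c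
      + (1 - c) * (∑ i, t i * trace (S i * (Θ + Ω i)) + ρ * matL1 Θ + γ * matL1p p Ω) := by
  have hterm : ∀ i, t i * (Real.log (c • Θ + (c • Ω) i).det - trace (S i * (c • Θ + (c • Ω) i)))
      = t i * (Real.log (Θ + Ω i).det - trace (S i * (Θ + Ω i))) + t i * (d * Real.log c)
        + (1 - c) * (t i * trace (S i * (Θ + Ω i))) := fun i => by
    rw [Pi.smul_apply, ← smul_add, det_smul, Fintype.card_fin,
      Real.log_mul (by positivity) (hdet i), Real.log_pow, Matrix.mul_smul, trace_smul,
      smul_eq_mul]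
    ring
  simp only [cssl, hterm, Finset.sum_add_distrib, ← Finset.sum_mul, ← Finset.mul_sum, htsum,
    matL1_smul hc.le, matL1p_smul hp hc.le]
  ring

end Objective

/-- Bounds on the eigenvalues of the CSSL solutions, expressed in the Loewner order:
`λᵢ^min • I ⪯ Θ* + Ωᵢ* ⪯ λᵢ^max • I`. -/
theorem cssl_eigenvalue_bounds (d N : ℕ) (hd : 1 ≤ d) (hN : 1 ≤ N)
    (S : Fin N → Matrix (Fin d) (Fin d) ℝ) (hS : ∀ i, (S i).PosSemidef)
    (t : Fin N → ℝ) (ht : ∀ i, 0 < t i) (htsum : ∑ i, t i = 1)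
    (p ρ γ : ℝ) (hp : 1 ≤ p) (hρ : 0 < ρ) (hργ : ρ < (N : ℝ) ^ (1 / p) * γ)
    (Θs : Matrix (Fin d) (Fin d) ℝ) (Ωs : Fin N → Matrix (Fin d) (Fin d) ℝ)
    (hfeas : ∀ i, (Θs + Ωs i).PosDef)
    (hmax : ∀ (Θ : Matrix (Fin d) (Fin d) ℝ) (Ω : Fin N → Matrix (Fin d) (Fin d) ℝ),
      (∀ i, (Θ + Ω i).PosDef) → cssl S t ρ γ p Θ Ω ≤ cssl S t ρ γ p Θs Ωs) :
    ∀ i, ((Θs + Ωs i) -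
          (t i / (t i * specNorm (S i) + d * γ)) • (1 : Matrix (Fin d) (Fin d) ℝ)).PosSemidef
      ∧ ((((N : ℝ) ^ (1 / p) * d ^ 2 / ρ) • (1 : Matrix (Fin d) (Fin d) ℝ)) -
          (Θs + Ωs i)).PosSemidef := by
  have hN0 : (1 : ℝ) ≤ (N : ℝ) ^ (1 / p) :=
    Real.one_le_rpow (by exact_mod_cast hN) (by positivity)
  have hd0 : (1 : ℝ) ≤ d := by exact_mod_cast hd
  have hγ : 0 < γ := by
    by_contra! h
    nlinarith
  intro i
  constructor
  · refine posSemidef_sub_smul_one_of_le_eigenvalues (hfeas i).isHermitian fun μ v hv hAv => ?_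
    have hv0 : v ≠ 0 := by rintro rfl; simp at hv
    have hμ : 0 < μ := by
      have h := (hfeas i).dotProduct_mulVec_pos hv0
      simpa [hAv, hv] using h
    have hti := ht i
    have hS0 : 0 ≤ specNorm (S i) := norm_nonneg _
    have hkey : t i * μ⁻¹ ≤ t i * specNorm (S i) + d * γ := by
      refine le_of_forall_log_one_add_le (inv_pos.mpr hμ) hti.le fun ε hε => ?_
      have hB : (ε • vecMulVec v v).PosSemidef := by
        simpa using (posSemidef_vecMulVec_self_star v).smul hε.le
      have hfeas' : ∀ k, (Θs + (Ωs + Pi.single i (ε • vecMulVec v v) :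
          Fin N → Matrix (Fin d) (Fin d) ℝ) k).PosDef := fun k => by
        rcases eq_or_ne k i with rfl | hk
        · rw [Pi.add_apply, Pi.single_eq_same, ← add_assoc]
          exact (hfeas k).add_posSemidef hB
        · rw [Pi.add_apply, Pi.single_eq_of_ne hk, add_zero]
          exact hfeas k
      have hopt := (cssl_add_single_ge S t ρ Θs Ωs hp hγ.le i (ε • vecMulVec v v)).trans
        (hmax _ _ hfeas')
      rw [det_add_smul_vecMulVec_of_eigenvector hμ.ne' hAv, hv, mul_one, div_eq_mul_inv,
        Real.log_mul (hfeas i).det_pos.ne' (by positivity), matL1_smul hε.le, Matrix.mul_smul,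
        trace_smul, smul_eq_mul, trace_mul_vecMulVec_self] at hopt
      have h1 := dotProduct_mulVec_le_specNorm (S i) v
      have h2 := matL1_vecMulVec_self_le v
      rw [hv, mul_one] at h1 h2
      have h3 := mul_le_mul_of_nonneg_left h1 (mul_pos (ht i) hε).le
      have h4 := mul_le_mul_of_nonneg_left h2 (mul_pos hγ hε).le
      linarith
    rw [div_le_iff₀ (by positivity)]
    rwa [← div_eq_mul_inv, div_le_iff₀' hμ] at hkey
  · refine posSemidef_smul_one_sub_of_matL1_le (hfeas i).isHermitian ?_
    have hK : ∑ k, t k * trace (S k * (Θs + Ωs k)) + ρ * matL1 Θs + γ * matL1p p Ωs ≤ d := by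
      refine le_of_forall_mul_log_le (by positivity) fun c h0 h1 => ?_
      have hopt := hmax (c • Θs) (c • Ωs) fun k => by
        simpa [← smul_add] using (hfeas k).smul h0
      rw [cssl_smul S t ρ Θs Ωs hp htsum (fun k => (hfeas k).det_pos.ne') h0] at hopt
      linarith
    have htr : 0 ≤ ∑ k, t k * trace (S k * (Θs + Ωs k)) :=
      Finset.sum_nonneg fun k _ =>
        mul_nonneg (ht k).le ((hS k).trace_mul_nonneg (hfeas k).posSemidef)
    have hΘ := matL1_nonneg Θs
    have hΩ := matL1p_nonneg p Ωs
    have hsum : ρ * (matL1 Θs + matL1p p Ωs) ≤ (N : ℝ) ^ (1 / p) * d := by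
      have h1 : ρ * matL1 Θs ≤ (N : ℝ) ^ (1 / p) * (ρ * matL1 Θs) :=
        le_mul_of_one_le_left (by positivity) hN0
      have h2 := mul_le_mul_of_nonneg_right hργ.le hΩ
      have h3 := mul_le_mul_of_nonneg_left (by linarith : ρ * matL1 Θs + γ * matL1p p Ωs ≤ d)
        (zero_le_one.trans hN0)
      linarith
    calc matL1 (Θs + Ωs i) ≤ matL1 Θs + matL1p p Ωs :=
          (matL1_add_le _ _).trans (by grw [matL1_le_matL1p hp i Ωs])
      _ ≤ (N : ℝ) ^ (1 / p) * d ^ 2 / ρ := by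
          rw [le_div_iff₀' hρ]
          refine hsum.trans ?_
          gcongr
          exact le_self_pow₀ hd0 two_ne_zero
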